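/- Let K be a compact metric space that is not totally disconnected (equivalently, has positive topological dimension), and let x ∈ supp K, where supp K = {x ∈ K : dim_tH B(x, r) = dim_tH K for every r > 0}. Then the set 𝓕_x = {f ∈ C(K) : dim_H f⁻¹(f(x)) = dim_tH K − 1} is co-meager in C(K). -/

import Mathlib

open MeasureTheory Topology Metric Set
open scoped Classical

/-- Hausdorff dimension of a subset of a metric space, as an extended real number, with the
convention that the empty set has dimension `-1`. -/
noncomputable def hdim {X : Type*} [EMetricSpace X] (s : Set X) : EReal :=
  if s = ∅ then -1 else (dimH s : EReal)

/-- The topological Hausdorff dimension of a metric space `X`: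
`dim_tH X = inf {d : X has a basis 𝒰 such that dim_H ∂U ≤ d − 1 for every U ∈ 𝒰}`, with the
convention `dim_tH ∅ = -1` (the infimum of the empty set of extended reals being `⊤`). -/
noncomputable def tHdim (X : Type*) [MetricSpace X] : EReal :=
  if Nonempty X then
    sInf {d : EReal | ∃ 𝒰 : Set (Set X), TopologicalSpace.IsTopologicalBasis 𝒰 ∧
      ∀ U ∈ 𝒰, hdim (frontier U) ≤ d - 1}
  else -1

/-- `HasSmallCover s ε A` says that `A` is covered by countably many open sets whose diameters,
raised to the power `s`, add up to less than `ε`. -/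
def HasSmallCover {X : Type*} [MetricSpace X] (s : ℝ) (ε : ENNReal) (A : Set X) : Prop :=
  ∃ t : ℕ → Set X, (∀ n, IsOpen (t n)) ∧ A ⊆ ⋃ n, t n ∧ ∑' n, ediam (t n) ^ s < ε

theorem HasSmallCover.mono {X : Type*} [MetricSpace X] {s : ℝ} {ε : ENNReal} {A B : Set X}
    (h : HasSmallCover s ε B) (hAB : A ⊆ B) : HasSmallCover s ε A :=
  let ⟨t, ho, hB, hs⟩ := h
  ⟨t, ho, hAB.trans hB, hs⟩

theorem exists_isOpen_superset_ediam_rpow_lt {X : Type*} [MetricSpace X] {s : ℝ} (hs : 0 < s)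
    {A : Set X} (hA : ediam A ≠ ⊤) {ε : ENNReal} (hε : ε ≠ 0) :
    ∃ U, IsOpen U ∧ A ⊆ U ∧ ediam U ^ s < ediam A ^ s + ε := by
  have hlt : ediam A ^ s < ediam A ^ s + ε :=
    ENNReal.lt_add_right (ENNReal.rpow_ne_top_of_nonneg hs.le hA) hε
  have hc : Continuous fun r : NNReal => (ediam A + 2 * (r : ENNReal)) ^ s := by
    refine (ENNReal.continuous_rpow_const).comp ?_
    exact continuous_const.add
      ((ENNReal.continuous_const_mul (by simp)).comp ENNReal.continuous_coe)
  have hev : ∀ᶠ r : NNReal in 𝓝 0, (ediam A + 2 * (r : ENNReal)) ^ s < ediam A ^ s + ε :=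
    hc.continuousAt.eventually_lt continuousAt_const (by simpa using hlt)
  obtain ⟨r, hr, hr0⟩ := (hev.filter_mono nhdsWithin_le_nhds |>.and
    (self_mem_nhdsWithin : Set.Ioi (0 : NNReal) ∈ 𝓝[>] 0)).exists
  refine ⟨thickening r A, isOpen_thickening, self_subset_thickening (by exact_mod_cast hr0) A, ?_⟩
  exact (ENNReal.rpow_le_rpow (ediam_thickening_le r) hs.le).trans_lt hr

theorem hasSmallCover_of_hausdorffMeasure_eq_zero {X : Type*} [MetricSpace X] [MeasurableSpace X]
    [BorelSpace X] {s : ℝ} (hs : 0 < s) {A : Set X} (hA : μH[s] A = 0) {ε : ENNReal}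
    (hε : ε ≠ 0) : HasSmallCover s ε A := by
  obtain ⟨δ, hδ0, hδ⟩ := ENNReal.exists_pos_sum_of_countable (ENNReal.half_pos hε).ne' ℕ
  rw [Measure.hausdorffMeasure_apply] at hA
  have h1 := le_of_eq hA
  simp only [iSup_le_iff] at h1
  have h2 := (h1 1 one_pos).trans_lt (ENNReal.half_pos hε)
  simp only [iInf_lt_iff] at h2
  obtain ⟨t, hAt, htd, hsum⟩ := h2
  have ht : ∀ n, ∃ U, IsOpen U ∧ t n ⊆ U ∧ ediam U ^ s < ediam (t n) ^ s + δ n := fun n =>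
    exists_isOpen_superset_ediam_rpow_lt hs ((htd n).trans_lt ENNReal.one_lt_top).ne
      (by exact_mod_cast (hδ0 n).ne')
  choose U hUo hU hUd using ht
  refine ⟨U, hUo, hAt.trans (iUnion_mono hU), ?_⟩
  have hterm : ∀ n, ediam (t n) ^ s = ⨆ _ : (t n).Nonempty, ediam (t n) ^ s := by
    intro n
    rcases (t n).eq_empty_or_nonempty with h | h
    · simp [h, hs]
    · simp [h]
  calc ∑' n, ediam (U n) ^ s ≤ ∑' n, (ediam (t n) ^ s + δ n) :=
        ENNReal.tsum_le_tsum fun n => (hUd n).le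
    _ = ∑' n, ediam (t n) ^ s + ∑' n, (δ n : ENNReal) := ENNReal.tsum_add
    _ < ε / 2 + ε / 2 := by
        refine ENNReal.add_lt_add ?_ hδ
        simpa only [← hterm] using hsum
    _ = ε := ENNReal.add_halves ε

theorem hausdorffMeasure_eq_zero_of_hasSmallCover {X : Type*} [MetricSpace X] [MeasurableSpace X]
    [BorelSpace X] {s : ℝ} (hs : 0 < s) {A : Set X}
    (h : ∀ n : ℕ, HasSmallCover s ((n : ENNReal) + 1)⁻¹ A) : μH[s] A = 0 := by
  rw [Measure.hausdorffMeasure_apply]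
  refine le_antisymm (iSup₂_le fun r hr => ?_) zero_le
  refine ENNReal.le_of_forall_pos_le_add fun ε hε _ => ?_
  have hm : min (ε : ENNReal) (r ^ s) ≠ 0 := by
    have h1 : 0 < r ^ s := ENNReal.rpow_pos_of_nonneg hr hs.le
    exact (lt_min (by exact_mod_cast hε) h1).ne'
  obtain ⟨n, hn⟩ := ENNReal.exists_inv_nat_lt hm
  obtain ⟨t, -, hAt, hsum⟩ := h n
  have hsum' : ∑' n, ediam (t n) ^ s < min (ε : ENNReal) (r ^ s) :=
    hsum.trans_le ((ENNReal.inv_le_inv.2 le_self_add).trans hn.le)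
  refine (iInf₂_le t hAt).trans ((iInf_le _ fun n => ?_).trans ?_)
  · exact (ENNReal.rpow_le_rpow_iff hs).1
      ((ENNReal.le_tsum n).trans (hsum'.le.trans (min_le_right _ _)))
  · rw [zero_add]
    exact (ENNReal.tsum_le_tsum (g := fun n => ediam (t n) ^ s) fun n => iSup_le fun _ => le_rfl).trans
      (hsum'.le.trans (min_le_left _ _))

/-- Adding one small open set to a set with a small cover. -/
theorem HasSmallCover.union {X : Type*} [MetricSpace X] {s : ℝ} {ε δ : ENNReal} {A U : Set X}
    (hA : HasSmallCover s ε A) (hU : IsOpen U) (hUd : ediam U ^ s < δ) :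
    HasSmallCover s (δ + ε) (U ∪ A) := by
  obtain ⟨t, ho, hAt, hsum⟩ := hA
  refine ⟨fun n => Nat.casesOn n U t, fun n => by cases n <;> simp [hU, ho], ?_, ?_⟩
  · refine union_subset (subset_iUnion_of_subset 0 subset_rfl) (hAt.trans ?_)
    exact iUnion_subset fun n => subset_iUnion_of_subset (n + 1) subset_rfl
  · rw [tsum_eq_zero_add' ENNReal.summable]
    exact ENNReal.add_lt_add hUd hsum

theorem exists_injective_forall_abs_sub_lt {ι : Type*} [Finite ι] (a : ι → ℝ) {δ : ℝ}
    (hδ : 0 < δ) : ∃ c : ι → ℝ, Function.Injective c ∧ ∀ i, |c i - a i| < δ := by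
  have := Fintype.ofFinite ι
  have key : ∀ i, ∃ t : Finset ℝ, (∀ y ∈ t, |y - a i| < δ) ∧ t.card = Fintype.card ι := fun i => by
    have hinf : (ball (a i) δ).Infinite := by
      rw [Real.ball_eq_Ioo]; exact Ioo_infinite (by linarith)
    obtain ⟨t, ht, hc⟩ := hinf.exists_subset_card_eq (Fintype.card ι)
    exact ⟨t, fun y hy => by simpa [Real.dist_eq] using ht hy, hc⟩
  choose t ht hc using key
  obtain ⟨c, hci, hct⟩ := (Finset.all_card_le_biUnion_card_iff_exists_injective t).1 fun S => by
    rcases S.eq_empty_or_nonempty with rfl | ⟨i, hi⟩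
    · simp
    · exact S.card_le_univ.trans
        ((hc i).ge.trans (Finset.card_le_card (Finset.subset_biUnion_of_mem t hi)))
  exact ⟨c, hci, fun i => ht i _ (hct i)⟩

theorem isOpen_setOf_hasSmallCover_level {K : Type*} [MetricSpace K] [CompactSpace K] (x : K)
    (s : ℝ) (ε : ENNReal) : IsOpen {f : C(K, ℝ) | HasSmallCover s ε (f ⁻¹' {f x})} := by
  refine isOpen_iff_mem_nhds.2 fun f hf => ?_
  obtain ⟨t, ho, hft, hsum⟩ := hf
  have hC : IsCompact (⋃ n, t n)ᶜ := (isOpen_iUnion ho).isClosed_compl.isCompact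
  have hcont : Continuous fun g : C(K, ℝ) => g - ContinuousMap.const K (g x) :=
    continuous_id.sub (ContinuousMap.continuous_const'.comp (continuous_eval_const x))
  have hev := hcont.continuousAt.eventually (ContinuousMap.eventually_mapsTo
    (f := f - ContinuousMap.const K (f x)) hC (isOpen_compl_singleton (x := (0 : ℝ)))
    fun y hy => by
      simp only [ContinuousMap.coe_sub, Pi.sub_apply, ContinuousMap.const_apply, mem_compl_iff,
        mem_singleton_iff, sub_eq_zero]
      exact fun h => hy (hft h))
  filter_upwards [hev] with g hg
  refine ⟨t, ho, fun y hy => ?_, hsum⟩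
  by_contra hyt
  have := hg hyt
  simp only [ContinuousMap.coe_sub, Pi.sub_apply, ContinuousMap.const_apply, mem_compl_iff,
    mem_singleton_iff, sub_eq_zero] at this
  exact this hy

/-- Outside the frontiers of finitely many sets, the family of those sets containing a given point
is locally constant. -/
theorem isLocallyConstant_membership {K ι : Type*} [TopologicalSpace K] [Finite ι] (U : ι → Set K)
    {C : Set K} (hC : ∀ i, Disjoint C (frontier (U i))) :
    IsLocallyConstant fun z : C => {i | (z : K) ∈ U i} := by
  refine (IsLocallyConstant.iff_eventually_eq _).2 fun z => ?_
  have hz : ∀ i, ∀ᶠ w : C in 𝓝 z, ((w : K) ∈ U i ↔ (z : K) ∈ U i) := fun i => by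
    have hzi : (z : K) ∉ frontier (U i) := fun h => (hC i).notMem_of_mem_left z.2 h
    by_cases hzU : (z : K) ∈ U i
    · have : (z : K) ∈ interior (U i) := by
        by_contra h
        exact hzi ⟨subset_closure hzU, h⟩
      filter_upwards [continuous_subtype_val.continuousAt.eventually
        (mem_interior_iff_mem_nhds.1 this)] with w hw
      exact iff_of_true hw hzU
    · have : (z : K) ∈ (closure (U i))ᶜ := fun h => hzi ⟨h, fun h' => hzU (interior_subset h')⟩
      filter_upwards [continuous_subtype_val.continuousAt.eventually
        (isClosed_closure.isOpen_compl.mem_nhds this)] with w hw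
      exact iff_of_false (fun h => hw (subset_closure h)) hzU
  filter_upwards [Filter.eventually_all.2 hz] with w hw
  ext i
  exact hw i

theorem dense_setOf_hasSmallCover_level {K : Type*} [MetricSpace K] [CompactSpace K] (x : K)
    [MeasurableSpace K] [BorelSpace K] {s : ℝ} (hs : 0 < s) {𝒰 : Set (Set K)}
    (h𝒰 : TopologicalSpace.IsTopologicalBasis 𝒰) (hfr : ∀ U ∈ 𝒰, μH[s] (frontier U) = 0)
    {ε : ENNReal} (hε : ε ≠ 0) : Dense {f : C(K, ℝ) | HasSmallCover s ε (f ⁻¹' {f x})} := by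
  refine Metric.dense_iff.2 fun f δ hδ => ?_
  have hε2 : ε / 2 ≠ 0 := (ENNReal.half_pos hε).ne'
  have hnhds : ∀ y : K, ∃ U ∈ 𝒰, y ∈ U ∧ ediam U ^ s < ε / 2 ∧ ∀ z ∈ U, |f z - f y| < δ / 4 := by
    intro y
    obtain ⟨V, hVo, hyV, hV⟩ := exists_isOpen_superset_ediam_rpow_lt hs (A := {y}) (by simp) hε2
    rw [ediam_singleton, ENNReal.zero_rpow_of_pos hs, zero_add] at hV
    have hW : V ∩ f ⁻¹' ball (f y) (δ / 4) ∈ 𝓝 y :=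
      Filter.inter_mem (hVo.mem_nhds (hyV rfl))
        (f.continuous.continuousAt (ball_mem_nhds _ (by positivity)))
    obtain ⟨U, hU, hyU, hUW⟩ := h𝒰.mem_nhds_iff.1 hW
    refine ⟨U, hU, hyU, (ENNReal.rpow_le_rpow (ediam_mono fun z hz => (hUW hz).1) hs.le).trans_lt hV,
      fun z hz => ?_⟩
    simpa [Real.dist_eq] using (hUW hz).2
  choose U hU𝒰 hyU hUd hUf using hnhds
  obtain ⟨T, hT⟩ := isCompact_univ.elim_finite_subcover U (fun y => h𝒰.isOpen (hU𝒰 y))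
    (fun y _ => mem_iUnion.2 ⟨y, hyU y⟩)
  have hF : μH[s] (⋃ i : T, frontier (U i)) = 0 :=
    measure_iUnion_null fun i => hfr _ (hU𝒰 i)
  obtain ⟨t, hto, hFt, hsum⟩ := hasSmallCover_of_hausdorffMeasure_eq_zero hs hF hε2
  set C : Set K := (⋃ n, t n)ᶜ with hC
  have hCc : IsClosed C := (isOpen_iUnion hto).isClosed_compl
  have : CompactSpace C := isCompact_iff_compactSpace.1 hCc.isCompact
  have hloc := isLocallyConstant_membership (fun i : T => U i) (C := C) fun i =>
    disjoint_compl_left_iff_subset.2 ((subset_iUnion (fun i : T => frontier (U i)) i).trans hFt)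
  set π : C → Set T := fun z => {i | (z : K) ∈ U i} with hπ
  have hne : ∀ z, (π z).Nonempty := fun z => by
    obtain ⟨i, hi, hz⟩ := mem_iUnion₂.1 (hT (mem_univ (z : K)))
    exact ⟨⟨i, hi⟩, hz⟩
  obtain ⟨c, hcinj, hc⟩ := exists_injective_forall_abs_sub_lt
    (fun A : Set T => if h : A.Nonempty then f (h.some : T) else 0)
    (show 0 < δ / 4 by positivity)
  have hclose : ∀ z : C, |c (π z) - f z| < δ / 2 := fun z => by
    have h1 := hc (π z)
    rw [dif_pos (hne z)] at h1
    have h2 := hUf _ z (show (z : K) ∈ U (hne z).some from (hne z).some_mem)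
    rw [abs_lt] at *
    constructor <;> linarith
  let h : C(C, ℝ) := ⟨fun z => c (π z) - f z, (hloc.comp c).continuous.sub (by fun_prop)⟩
  obtain ⟨g, hg, hgh⟩ := BoundedContinuousFunction.exists_forall_mem_domRestrict_eq_of_closed
    (BoundedContinuousFunction.mkOfCompact (α := C) h) hCc (t := Icc (-(δ / 2)) (δ / 2))
    (fun z => abs_le.1 (hclose z).le) ⟨0, by constructor <;> linarith⟩
  have hgC : ∀ z : C, f z + g z = c (π z) := fun z => by
    have : g z = c (π z) - f z := DFunLike.congr_fun hgh z
    rw [this]; ring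
  refine ⟨f + g.toContinuousMap, ?_, ?_⟩
  · rw [mem_ball, ContinuousMap.dist_lt_iff hδ]
    intro z
    have := abs_le.2 (hg z)
    simp only [ContinuousMap.add_apply, Real.dist_eq, add_sub_cancel_left]
    exact this.trans_lt (by linarith)
  · by_cases hz : ∃ z : C, f z + g z = f x + g x
    · obtain ⟨z, hz⟩ := hz
      have hcov : HasSmallCover s (ε / 2 + ε / 2) (U (hne z).some ∪ ⋃ n, t n) :=
        HasSmallCover.union ⟨t, hto, subset_rfl, hsum⟩ (h𝒰.isOpen (hU𝒰 _)) (hUd _)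
      rw [ENNReal.add_halves] at hcov
      refine hcov.mono fun w hw => ?_
      by_cases hwC : w ∈ C
      · have hw' : f w + g w = f x + g x := hw
        have hpat : π ⟨w, hwC⟩ = π z := hcinj (by rw [← hgC, ← hgC, hz]; exact hw')
        have hmem : (hne z).some ∈ π ⟨w, hwC⟩ := by
          rw [hpat]; exact (hne z).some_mem
        exact Or.inl hmem
      · exact Or.inr (not_not.1 hwC)
    · refine HasSmallCover.mono ⟨t, hto, subset_rfl, hsum.trans_le ENNReal.half_le_self⟩ fun w hw => ?_
      by_contra hwC
      exact hz ⟨⟨w, hwC⟩, hw⟩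

theorem eventually_residual_dimH_level_le {K : Type*} [MetricSpace K] [CompactSpace K] (x : K)
    {s : NNReal} (hs : 0 < s) {𝒰 : Set (Set K)} (h𝒰 : TopologicalSpace.IsTopologicalBasis 𝒰)
    (hfr : ∀ U ∈ 𝒰, dimH (frontier U) < s) :
    ∀ᶠ f : C(K, ℝ) in residual C(K, ℝ), dimH (f ⁻¹' {f x}) ≤ s := by
  borelize K
  have hs' : (0 : ℝ) < s := hs
  have hn : ∀ n : ℕ, ∀ᶠ f : C(K, ℝ) in residual C(K, ℝ),
      HasSmallCover s ((n : ENNReal) + 1)⁻¹ (f ⁻¹' {f x}) := fun n =>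
    residual_of_dense_open (isOpen_setOf_hasSmallCover_level x s _)
      (dense_setOf_hasSmallCover_level x hs' h𝒰
        (fun U hU => hausdorffMeasure_of_dimH_lt (hfr U hU)) (by simp))
  filter_upwards [eventually_countable_forall.2 hn] with f hf
  refine dimH_le_of_hausdorffMeasure_ne_top ?_
  rw [hausdorffMeasure_eq_zero_of_hasSmallCover hs' hf]
  exact ENNReal.zero_ne_top

/-- A neighbourhood basis of sets with small frontier at all points but one yields such a
neighbourhood basis at the remaining point. -/
theorem isTopologicalBasis_dimH_frontier_le {B : Type*} [MetricSpace B] [CompactSpace B] (x : B)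
    {s : ENNReal} (H : ∀ p ≠ x, ∀ r > 0, ∃ U, IsOpen U ∧ p ∈ U ∧ U ⊆ ball p r ∧
      dimH (frontier U) ≤ s) :
    TopologicalSpace.IsTopologicalBasis {U : Set B | IsOpen U ∧ dimH (frontier U) ≤ s} := by
  refine TopologicalSpace.isTopologicalBasis_of_isOpen_of_nhds (fun U hU => hU.1)
    fun p V hp hV => ?_
  obtain ⟨r, hr, hrV⟩ := Metric.isOpen_iff.1 hV p hp
  by_cases hpx : p = x
  · subst hpx
    have hex : ∀ q : B, ∃ U, IsOpen U ∧ (q ≠ p → q ∈ U) ∧ p ∉ closure U ∧ dimH (frontier U) ≤ s := by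
      intro q
      by_cases hq : q = p
      · exact ⟨∅, isOpen_empty, fun h => absurd hq h, by simp, by simp⟩
      · have hd : 0 < dist q p := dist_pos.2 hq
        obtain ⟨U, hUo, hqU, hUb, hUs⟩ := H q hq (dist q p / 2) (by positivity)
        refine ⟨U, hUo, fun _ => hqU, fun h => ?_, hUs⟩
        have := closure_ball_subset_closedBall (closure_mono hUb h)
        rw [mem_closedBall, dist_comm] at this
        linarith
    choose U hUo hqU hpU hUs using hex
    have hqU' : ∀ q ∈ sphere p (r / 2), q ∈ U q := fun q hq => hqU q (ne_of_mem_sphere hq (by positivity))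
    obtain ⟨T, hT⟩ := (isCompact_sphere p (r / 2)).elim_finite_subcover U hUo
      (fun q hq => mem_iUnion.2 ⟨q, hqU' q hq⟩)
    set F : Set B := ⋃ q ∈ T, closure (U q) with hF
    have hFc : IsClosed F := T.finite_toSet.isClosed_biUnion fun q _ => isClosed_closure
    have hWo : IsOpen (ball p (r / 2) \ F) := isOpen_ball.sdiff hFc
    refine ⟨ball p (r / 2) \ F, ⟨hWo, ?_⟩, ⟨mem_ball_self (by positivity), ?_⟩, ?_⟩
    · have hsub : frontier (ball p (r / 2) \ F) ⊆ ⋃ q ∈ T, frontier (U q) := by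
        intro z hz
        rw [hWo.frontier_eq] at hz
        have hzU : ∀ q ∈ T, z ∉ U q := fun q hq hzq => by
          obtain ⟨w, hwU, hw⟩ := mem_closure_iff.1 hz.1 _ (hUo q) hzq
          exact hw.2 (mem_iUnion₂.2 ⟨q, hq, subset_closure hwU⟩)
        have hzle : dist z p ≤ r / 2 := closure_ball_subset_closedBall (closure_mono sdiff_subset hz.1)
        rcases hzle.lt_or_eq with hlt | heq
        · have hzF : z ∈ F := by
            by_contra hzF
            exact hz.2 ⟨hlt, hzF⟩
          obtain ⟨q, hq, hzq⟩ := mem_iUnion₂.1 hzF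
          refine mem_iUnion₂.2 ⟨q, hq, ?_⟩
          rw [(hUo q).frontier_eq]
          exact ⟨hzq, hzU q hq⟩
        · obtain ⟨q, hq, hzq⟩ := mem_iUnion₂.1 (hT heq)
          exact absurd hzq (hzU q hq)
      refine (dimH_mono hsub).trans ?_
      refine (dimH_bUnion (s := (T : Set B)) T.countable_toSet _).trans_le ?_
      exact iSup₂_le fun q _ => hUs q
    · rw [hF, mem_iUnion₂]
      rintro ⟨q, -, hq⟩
      exact hpU q hq
    · exact sdiff_subset.trans ((ball_subset_ball (by linarith)).trans hrV)
  · obtain ⟨U, hUo, hpU, hUb, hUs⟩ := H p hpx r hr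
    exact ⟨U, ⟨hUo, hUs⟩, hpU, hUb.trans hrV⟩

theorem tHdim_le_of_isTopologicalBasis {B : Type*} [MetricSpace B] [Nonempty B] {s : NNReal}
    (h : TopologicalSpace.IsTopologicalBasis
      {U : Set B | IsOpen U ∧ dimH (frontier U) ≤ (s : ENNReal)}) :
    tHdim B ≤ ((s : ENNReal) : EReal) + 1 := by
  rw [tHdim, if_pos ‹_›]
  refine sInf_le ⟨_, h, fun U hU => ?_⟩
  have h1 : ((s : ENNReal) : EReal) + 1 - 1 = ((s : ENNReal) : EReal) :=
    EReal.add_sub_cancel_right (b := 1)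
  rw [h1, hdim]
  split_ifs
  · exact le_trans (by norm_num) (EReal.coe_ennreal_nonneg _)
  · exact EReal.coe_ennreal_le_coe_ennreal_iff.2 hU.2

/-- If functions whose level set through `x` has dimension at most `s` are dense near `f`, then a
point `p ≠ x` of a ball on which `f` is almost constant has small neighbourhoods, relative to
that ball, with frontier of dimension at most `s`. -/
theorem exists_isOpen_dimH_frontier_le {K : Type*} [MetricSpace K] [CompactSpace K] {x : K}
    {s : ENNReal} {f : C(K, ℝ)} {δ r : ℝ} (hδ : 0 < δ) (hxr : 0 ≤ r)
    (hf : ball f δ ⊆ closure {g : C(K, ℝ) | dimH (g ⁻¹' {g x}) ≤ s})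
    (hr : ∀ y ∈ closedBall x r, |f y - f x| ≤ δ / 4) (p : closedBall x r) (hp : (p : K) ≠ x)
    {η : ℝ} (hη : 0 < η) :
    ∃ U : Set (closedBall x r), IsOpen U ∧ p ∈ U ∧ U ⊆ ball p η ∧ dimH (frontier U) ≤ s := by
  have hd : 0 < dist (p : K) x := dist_pos.2 hp
  set ρ : ℝ := min (η / 2) (dist (p : K) x / 2) with hρ
  have hρ0 : 0 < ρ := lt_min (by positivity) (by positivity)
  have hρη : ρ < η := (min_le_left _ _).trans_lt (by linarith)
  have hρd : 2 * ρ ≤ dist (p : K) x := by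
    have := min_le_right (η / 2) (dist (p : K) x / 2)
    linarith
  let k : K → ℝ := fun y => -1 + 2 * max 0 (1 - dist y p / ρ) + max 0 (1 - dist y x / ρ)
  let a : K → ℝ := fun y => max (-(δ / 4)) (min (f x - f y) (δ / 4))
  have hfar : ∀ y q : K, ρ ≤ dist y q → max 0 (1 - dist y q / ρ) = 0 := fun y q h => by
    refine max_eq_left ?_
    rw [sub_nonpos, le_div_iff₀ hρ0]
    linarith
  have hbump : ∀ y q : K, 0 ≤ max 0 (1 - dist y q / ρ) ∧ max 0 (1 - dist y q / ρ) ≤ 1 :=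
    fun y q => ⟨le_max_left _ _, max_le zero_le_one (by
      have : 0 ≤ dist y q / ρ := by positivity
      linarith)⟩
  let h : C(K, ℝ) := ⟨fun y => f y + a y + δ / 8 * k y, by fun_prop⟩
  have hk : ∀ y, |k y| ≤ 2 := fun y => by
    have h1 := hbump y p
    have h2 := hbump y x
    rw [abs_le]
    refine ⟨by simp only [k]; linarith, by simp only [k]; linarith⟩
  have hhf : h ∈ ball f δ := by
    rw [mem_ball, ContinuousMap.dist_lt_iff hδ]
    intro y
    have h1 : |a y| ≤ δ / 4 :=
      abs_le.2 ⟨le_max_left _ _, max_le (by linarith) (min_le_right _ _)⟩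
    have h2 := abs_le.1 (hk y)
    rw [abs_le] at h1
    have h3 : h y - f y = a y + δ / 8 * k y := by simp only [h, ContinuousMap.coe_mk]; ring
    rw [Real.dist_eq, h3, abs_lt]
    constructor <;> nlinarith
  have hB : ∀ y ∈ closedBall x r, h y = f x + δ / 8 * k y := fun y hy => by
    have h1 := abs_le.1 (hr y hy)
    have : a y = f x - f y := by
      simp only [a]
      rw [min_eq_left (by linarith), max_eq_right (by linarith)]
    simp only [h, ContinuousMap.coe_mk, this]; ring
  obtain ⟨g, hg, hgh⟩ := Metric.mem_closure_iff.1 (hf hhf) (δ / 32) (by positivity)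
  have hgy : ∀ y, |h y - g y| < δ / 32 := fun y =>
    (ContinuousMap.dist_lt_iff (by positivity)).1 hgh y
  have hxB : x ∈ closedBall x r := mem_closedBall_self hxr
  have kx : k x = 0 := by
    simp only [k]
    rw [hfar x p (by rw [dist_comm]; linarith)]
    simp
  have kp : k p = 1 := by
    simp only [k]
    rw [hfar p x (by linarith)]
    norm_num
  have hgx := abs_lt.1 (hgy x)
  rw [hB x hxB, kx] at hgx
  have hgp : g x < g p := by
    have := abs_lt.1 (hgy p)
    rw [hB p p.2, kp] at this
    linarith
  have hgfar : ∀ y ∈ closedBall x r, ρ ≤ dist y p → ρ ≤ dist y x → g y < g x :=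
    fun y hy h1 h2 => by
      have := abs_lt.1 (hgy y)
      have ky : k y = -1 := by
        simp only [k]
        rw [hfar y p h1, hfar y x h2]
        norm_num
      rw [hB y hy, ky] at this
      linarith
  have hgc : Continuous fun y : closedBall x r => g y := by fun_prop
  have hpc : Continuous fun y : closedBall x r => dist (y : K) p := by fun_prop
  have hUo : IsOpen {y : closedBall x r | g x < g y ∧ dist (y : K) p < ρ} :=
    (isOpen_lt continuous_const hgc).inter (isOpen_lt hpc continuous_const)
  refine ⟨{y | g x < g y ∧ dist (y : K) p < ρ}, hUo, ⟨hgp, by simpa using hρ0⟩,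
    fun y hy => hy.2.trans hρη, ?_⟩
  have hsub : Subtype.val '' frontier {y : closedBall x r | g x < g y ∧ dist (y : K) p < ρ} ⊆
      g ⁻¹' {g x} := by
    rintro _ ⟨y, hy, rfl⟩
    rw [hUo.frontier_eq] at hy
    have hcl : g x ≤ g y ∧ dist (y : K) p ≤ ρ :=
      closure_minimal (t := {y : closedBall x r | g x ≤ g y ∧ dist (y : K) p ≤ ρ})
        (fun z hz => ⟨hz.1.le, hz.2.le⟩)
        ((isClosed_le continuous_const hgc).inter (isClosed_le hpc continuous_const)) hy.1
    by_contra hne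
    have hlt : g x < g y := lt_of_le_of_ne hcl.1 fun h => hne h.symm
    have hpy : ρ ≤ dist (y : K) p := not_lt.1 fun h => hy.2 ⟨hlt, h⟩
    have hyx : ρ ≤ dist (y : K) x := by
      have := dist_triangle_left (p : K) x y
      linarith [hcl.2]
    exact absurd (hgfar y y.2 hpy hyx) hlt.not_gt
  rw [← isometry_subtype_coe.dimH_image]
  exact (dimH_mono hsub).trans hg

theorem eventually_residual_lt_dimH_level {K : Type*} [MetricSpace K] [CompactSpace K] (x : K)
    {s : NNReal} (hs : ∀ r : ℝ, 0 < r → ((s : ENNReal) : EReal) + 1 < tHdim (closedBall x r)) :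
    ∀ᶠ f : C(K, ℝ) in residual C(K, ℝ), (s : ENNReal) < dimH (f ⁻¹' {f x}) := by
  set Z : Set C(K, ℝ) := {f | dimH (f ⁻¹' {f x}) ≤ s} with hZ
  have hdense : Dense (interior Zᶜ) := by
    rw [interior_compl, ← interior_eq_empty_iff_dense_compl, eq_empty_iff_forall_notMem]
    intro f hf
    obtain ⟨δ, hδ, hfδ⟩ := Metric.isOpen_iff.1 isOpen_interior f hf
    obtain ⟨r, hr, hfr⟩ := Metric.nhds_basis_closedBall.mem_iff.1
      (f.continuous.continuousAt (closedBall_mem_nhds (f x) (show 0 < δ / 4 by positivity)))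
    have : CompactSpace (closedBall x r) :=
      isCompact_iff_compactSpace.1 isClosed_closedBall.isCompact
    let x' : closedBall x r := ⟨x, mem_closedBall_self hr.le⟩
    have : Nonempty (closedBall x r) := ⟨x'⟩
    refine (hs r hr).not_ge (tHdim_le_of_isTopologicalBasis
      (isTopologicalBasis_dimH_frontier_le x' fun p hp η hη =>
        exists_isOpen_dimH_frontier_le hδ hr.le (hfδ.trans interior_subset)
          (fun y hy => ?_) p (fun h => hp (Subtype.ext h)) hη))
    simpa [Real.dist_eq] using hfr hy
  filter_upwards [residual_of_dense_open isOpen_interior hdense] with f hf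
  exact not_le.1 (interior_subset hf)

theorem one_le_tHdim {K : Type*} [MetricSpace K] [Nonempty K]
    (hK : ¬ TotallyDisconnectedSpace K) : 1 ≤ tHdim K := by
  by_contra! hlt
  rw [tHdim, if_pos ‹_›, sInf_lt_iff] at hlt
  obtain ⟨d, ⟨𝒰, h𝒰, hd⟩, hd1⟩ := hlt
  have hcl : ∀ U ∈ 𝒰, IsClopen U := fun U hU => by
    rw [isClopen_iff_frontier_eq_empty]
    by_contra hne
    have h1 := hd U hU
    rw [hdim, if_neg hne] at h1
    have h2 : d - 1 < 0 :=
      (EReal.sub_lt_iff (.inl (EReal.coe_ne_bot 1)) (.inl (EReal.coe_ne_top 1))).2 (by simpa)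
    exact absurd (EReal.coe_ennreal_nonneg _) (h1.trans_lt h2).not_ge
  have : TotallySeparatedSpace K := totallySeparatedSpace_iff_exists_isClopen.2 fun y z hyz => by
    obtain ⟨U, hU, hy, hUz⟩ := h𝒰.mem_nhds_iff.1 (isOpen_compl_singleton.mem_nhds hyz)
    exact ⟨U, hcl U hU, hy, fun hz => hUz hz rfl⟩
  exact hK inferInstance

theorem exists_basis_dimH_frontier_lt {K : Type*} [MetricSpace K] [Nonempty K] {s : NNReal} (hs0 : 0 < s)
    (hs : tHdim K < ((s : ENNReal) : EReal) + 1) :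
    ∃ 𝒰 : Set (Set K), TopologicalSpace.IsTopologicalBasis 𝒰 ∧
      ∀ U ∈ 𝒰, dimH (frontier U) < s := by
  rw [tHdim, if_pos ‹_›, sInf_lt_iff] at hs
  obtain ⟨d, ⟨𝒰, h𝒰, hd⟩, hd1⟩ := hs
  refine ⟨𝒰, h𝒰, fun U hU => ?_⟩
  have h1 := hd U hU
  have h2 : d - 1 < ((s : ENNReal) : EReal) :=
    (EReal.sub_lt_iff (.inl (EReal.coe_ne_bot 1)) (.inl (EReal.coe_ne_top 1))).2 hd1
  rw [hdim] at h1
  split_ifs at h1 with hne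
  · rw [hne, dimH_empty]; exact_mod_cast hs0
  · exact EReal.coe_ennreal_lt_coe_ennreal_iff.1 (h1.trans_lt h2)

/-- Let `K` be a compact metric space which is not totally disconnected and
let `x ∈ supp K`, i.e. `dim_tH B(x, r) = dim_tH K` for every `r > 0`. Then
`𝓕ₓ = {f ∈ C(K) : dim_H f⁻¹(f(x)) = dim_tH K − 1}` is co-meager in `C(K)`. -/
theorem comeager_level_through_supp_point
    {K : Type*} [MetricSpace K] [CompactSpace K] (hK : ¬ TotallyDisconnectedSpace K)
    (x : K) (hx : ∀ r : ℝ, 0 < r → tHdim ↥(closedBall x r) = tHdim K) :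
    {f : C(K, ℝ) | hdim (⇑f ⁻¹' {f x}) = tHdim K - 1} ∈ residual C(K, ℝ) := by
  have : Nonempty K := ⟨x⟩
  have hnonneg : 0 ≤ tHdim K - 1 :=
    (EReal.sub_nonneg (.inr (EReal.coe_ne_top 1)) (.inr (EReal.coe_ne_bot 1))).2 (one_le_tHdim hK)
  obtain ⟨e, he⟩ : ∃ e : ENNReal, (e : EReal) = tHdim K - 1 := ⟨_, EReal.coe_toENNReal hnonneg⟩
  have heD : tHdim K = (e : EReal) + 1 := by
    rw [he]; exact (EReal.sub_add_cancel (b := 1)).symm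
  have hadd : ∀ a b : ENNReal, a < b → (a : EReal) + 1 < (b : EReal) + 1 := fun a b hab =>
    EReal.add_lt_add_right_coe (EReal.coe_ennreal_lt_coe_ennreal_iff.2 hab) 1
  have hupper : ∀ q : ℚ, ∀ᶠ f : C(K, ℝ) in residual C(K, ℝ),
      e < Real.toNNReal q → dimH (f ⁻¹' {f x}) ≤ Real.toNNReal q := fun q => by
    by_cases hq : e < Real.toNNReal q
    · have hq0 : 0 < Real.toNNReal q := by exact_mod_cast (zero_le (a := e)).trans_lt hq
      obtain ⟨𝒰, h𝒰, hfr⟩ := exists_basis_dimH_frontier_lt hq0 (heD.trans_lt (hadd _ _ hq))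
      filter_upwards [eventually_residual_dimH_level_le x hq0 h𝒰 hfr] with f hf _ using hf
    · exact .of_forall fun f h => absurd h hq
  have hlower : ∀ q : ℚ, ∀ᶠ f : C(K, ℝ) in residual C(K, ℝ),
      Real.toNNReal q < e → Real.toNNReal q < dimH (f ⁻¹' {f x}) := fun q => by
    by_cases hq : Real.toNNReal q < e
    · filter_upwards [eventually_residual_lt_dimH_level x (s := Real.toNNReal q) fun r hr => by
        rw [hx r hr, heD]; exact hadd _ _ hq] with f hf _ using hf
    · exact .of_forall fun f h => absurd h hq
  filter_upwards [eventually_countable_forall.2 hupper, eventually_countable_forall.2 hlower]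
    with f hfu hfl
  have hne : (⇑f ⁻¹' {f x}) ≠ ∅ := Nonempty.ne_empty ⟨x, rfl⟩
  change hdim _ = _
  rw [hdim, if_neg hne, ← he]
  congr 1
  refine le_antisymm (not_lt.1 fun h => ?_) (not_lt.1 fun h => ?_)
  · obtain ⟨q, -, h1, h2⟩ := ENNReal.lt_iff_exists_rat_btwn.1 h
    exact (hfu q h1).not_gt h2
  · obtain ⟨q, -, h1, h2⟩ := ENNReal.lt_iff_exists_rat_btwn.1 h
    exact (hfl q h2).not_gt h1
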